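/- Let a,b,c,α,β,γ be nonnegative integers such that all four triples (a,b,c), (a,β,γ), (α,b,γ), (α,β,c) are admissible. Set g(n,k) := 2k(n−k) and let m be defined by 2m = a+b+c+α+β+γ − max(a+α, b+β, c+γ). Then Δ(a,b,c,α,β,γ) is nonzero, its v-degree equals g(m+1, (a+b+c)/2 + 1) + g((−a+b+c)/2, m−(a+β+γ)/2) + g((a−b+c)/2, m−(α+b+γ)/2) + g((a+b−c)/2, m−(α+β+c)/2), and its leading coefficient equals (−1)^{m−(a+b+c)/2}. -/

import Mathlib

/-!
Common definitions for formalizing "Colored Jones polynomials without tails"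
(Lee--van der Veen).  We work in the field `RatFunc ℚ` of rational functions
in one variable `V` over `ℚ`.
-/

open Polynomial

noncomputable section

namespace CJP

/-- The variable `v` of the field `ℚ(v)`. -/
noncomputable def V : RatFunc ℚ := RatFunc.X

/-- The quantum integer `[k] = ∑_{j=0}^{k-1} v^(2(k-1)-4j)`, so that
`(v^2 - v^(-2)) * [k] = v^(2k) - v^(-2k)`; it is `0` for `k ≤ 0`. -/
noncomputable def qint (k : ℤ) : RatFunc ℚ :=
  ∑ j ∈ Finset.range k.toNat, V ^ (2 * (k - 1) - 4 * (j : ℤ))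

/-- The quantum factorial `[k]! = [1][2]⋯[k]` for `k ≥ 0`, and `0` for `k < 0`. -/
noncomputable def qfact (k : ℤ) : RatFunc ℚ :=
  if k < 0 then 0 else ∏ j ∈ Finset.range k.toNat, qint ((j : ℤ) + 1)

/-- `O^k = (-1)^k [k+1]`. -/
noncomputable def qO (k : ℤ) : RatFunc ℚ := (-1 : RatFunc ℚ) ^ k * qint (k + 1)

/-- The two-part quantum multinomial (quantum binomial) `[n; k, n-k]`. -/
noncomputable def qbinom (n k : ℤ) : RatFunc ℚ := qfact n / (qfact k * qfact (n - k))

/-- `θ(a,b,c) = O^((a+b+c)/2) ⬝ [(a+b+c)/2; (-a+b+c)/2, (a-b+c)/2, (a+b-c)/2]`. -/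
noncomputable def qtheta (a b c : ℤ) : RatFunc ℚ :=
  qO ((a + b + c) / 2) * (qfact ((a + b + c) / 2) /
    (qfact ((-a + b + c) / 2) * qfact ((a - b + c) / 2) * qfact ((a + b - c) / 2)))

/-- The normalized 6j-symbol
`Δ(a,b,c,α,β,γ) = ∑_z (O^z / O^((a+b+c)/2)) [z; (a+b+c)/2, z-(a+b+c)/2] ⋯`.
Only finitely many `z` give a nonzero summand, so the `finsum` is well defined. -/
noncomputable def qdelta (a b c α β γ : ℤ) : RatFunc ℚ :=
  ∑ᶠ z : ℤ, (qO z / qO ((a + b + c) / 2)) * qbinom z ((a + b + c) / 2) *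
    qbinom ((-a + b + c) / 2) (z - (a + β + γ) / 2) *
    qbinom ((a - b + c) / 2) (z - (α + b + γ) / 2) *
    qbinom ((a + b - c) / 2) (z - (α + β + c) / 2)

/-- The framing factor `f(a) = i^(-a) v^(-a(a+2)/2)`, written for even `a`
(where it equals `(-1)^(a/2) v^(-a(a+2)/2)`, an element of `ℤ[v,v⁻¹]`). -/
noncomputable def qf (a : ℤ) : RatFunc ℚ :=
  (-1 : RatFunc ℚ) ^ (a / 2) * V ^ (-(a * (a + 2)) / 2)

/-- `f(a)^e = i^(-a e) v^(-a(a+2)e/2)` for `a*e` even, where it equals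
`(-1)^(a e / 2) v^(-a(a+2)e/2)`. -/
noncomputable def qfpow (a e : ℤ) : RatFunc ℚ :=
  (-1 : RatFunc ℚ) ^ (a * e / 2) * V ^ (-(a * (a + 2) * e) / 2)

/-- `x ∈ ℚ(v)` is a Laurent polynomial with integer coefficients: for some `m`,
`x * v^m` is (the image in `ℚ(v)` of) a polynomial with integer coefficients. -/
def IsIntLaurent (x : RatFunc ℚ) : Prop :=
  ∃ (p : Polynomial ℤ) (m : ℕ),
    x * V ^ m = algebraMap (Polynomial ℚ) (RatFunc ℚ) (p.map (Int.castRingHom ℚ))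

/-- The leading coefficient of a rational function : the ratio of the leading
coefficients of its numerator and denominator. -/
noncomputable def leadC (x : RatFunc ℚ) : ℚ := x.num.leadingCoeff / x.denom.leadingCoeff

/-- Admissibility of a triple of nonnegative integers. -/
def Admissible (a b c : ℤ) : Prop := 2 ∣ (a + b + c) ∧ |a - b| ≤ c ∧ c ≤ a + b

/-- Membership of an integer lattice point in the polytope `nP`, where
`P = {(a,b,c,d) ∈ [0,1]⁴ : |a-b| ≤ c ≤ a+b}`. -/
def inP (n a b c d : ℤ) : Prop :=
  0 ≤ a ∧ a ≤ n ∧ 0 ≤ b ∧ b ≤ n ∧ 0 ≤ c ∧ c ≤ n ∧ 0 ≤ d ∧ d ≤ n ∧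
    |a - b| ≤ c ∧ c ≤ a + b

/-- The summand `T_{a,b,c,d}` of the state sum for the colored Jones polynomial
`J_{C(r,s,t,u),n+1}`. -/
noncomputable def T (r s t u n a b c d : ℤ) : RatFunc ℚ :=
  (qdelta (2*a) (2*b) (2*c) n n n) ^ 2 * qdelta (2*b) n n (2*d) n n *
    qO (2*a) * qO (2*b) * qO (2*c) * qO (2*d) *
    qf (2*a) ^ r * qf (2*b) ^ s * qf (2*c) ^ t * qf (2*d) ^ (-u) *
    qtheta (2*a) (2*b) (2*c) /
    (qtheta (2*a) n n * qtheta (2*b) n n * qtheta (2*c) n n * qtheta (2*d) n n)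

/-- The state sum `J(r,s,t,u; n+1)`, i.e. the `(n+1)`-colored Jones polynomial of the
`0`-framed Montesinos knot `C(r,s,t,u)`:
`f(n)^(-2(r-s+t-u)-2r-2s-2t+2u) ⬝ ∑_{(a,b,c,d) ∈ nP ∩ ℤ⁴} T_{a,b,c,d}`. -/
noncomputable def J (r s t u n : ℤ) : RatFunc ℚ :=
  qfpow n (-2*(r - s + t - u) - 2*r - 2*s - 2*t + 2*u) *
    ∑ a ∈ Finset.Icc 0 n, ∑ b ∈ Finset.Icc 0 n, ∑ c ∈ Finset.Icc 0 n,
      ∑ d ∈ Finset.Icc 0 n,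
        if |a - b| ≤ c ∧ c ≤ a + b then T r s t u n a b c d else 0

end CJP

namespace CJP
/-- `g(n,k) = 2k(n-k)`. -/
def g (n k : ℤ) : ℤ := 2 * k * (n - k)
end CJP

namespace CJP

theorem leadC_mul (x y : RatFunc ℚ) : leadC (x * y) = leadC x * leadC y := by
  have h := congrArg Polynomial.leadingCoeff (RatFunc.num_denom_mul x y)
  simp only [Polynomial.leadingCoeff_mul, (RatFunc.monic_denom _).leadingCoeff, mul_one] at h
  simp [leadC, (RatFunc.monic_denom _).leadingCoeff, h]

/-- `leadC` as a multiplicative homomorphism. -/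
def leadCHom : RatFunc ℚ →*₀ ℚ where
  toFun := leadC
  map_zero' := by simp [leadC]
  map_one' := by simp [leadC]
  map_mul' := leadC_mul

/-- `x` is nonzero, of degree `d` and with leading coefficient `c`. -/
def HasLead (x : RatFunc ℚ) (d : ℤ) (c : ℚ) : Prop :=
  x ≠ 0 ∧ x.intDegree = d ∧ leadC x = c

/-- `x` is zero or has degree less than `d`. -/
def DegLT (x : RatFunc ℚ) (d : ℤ) : Prop := x = 0 ∨ x.intDegree < d

namespace HasLead

variable {x y : RatFunc ℚ} {d e : ℤ} {r s : ℚ}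

theorem mul (hx : HasLead x d r) (hy : HasLead y e s) : HasLead (x * y) (d + e) (r * s) := by
  obtain ⟨hx, rfl, rfl⟩ := hx
  obtain ⟨hy, rfl, rfl⟩ := hy
  exact ⟨mul_ne_zero hx hy, RatFunc.intDegree_mul hx hy, leadC_mul x y⟩

theorem inv (hx : HasLead x d r) : HasLead x⁻¹ (-d) r⁻¹ := by
  obtain ⟨hx, rfl, rfl⟩ := hx
  exact ⟨inv_ne_zero hx, RatFunc.intDegree_inv x, map_inv₀ leadCHom x⟩

theorem div (hx : HasLead x d r) (hy : HasLead y e s) : HasLead (x / y) (d - e) (r / s) := by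
  simpa only [div_eq_mul_inv, sub_eq_add_neg] using hx.mul hy.inv

theorem one : HasLead 1 0 1 :=
  ⟨one_ne_zero, RatFunc.intDegree_one, map_one leadCHom⟩

theorem pow (hx : HasLead x d r) (n : ℕ) : HasLead (x ^ n) (n * d) (r ^ n) := by
  induction n with
  | zero => simpa using one
  | succ n ih =>
    rw [pow_succ, pow_succ]
    convert ih.mul hx using 1
    push_cast
    ring

theorem zpow (hx : HasLead x d r) (n : ℤ) : HasLead (x ^ n) (n * d) (r ^ n) := by
  obtain ⟨n, rfl | rfl⟩ := n.eq_nat_or_neg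
  · simpa using hx.pow n
  · simpa using (hx.pow n).inv

theorem prod {ι : Type*} (t : Finset ι) {f : ι → RatFunc ℚ} {d : ι → ℤ} {c : ι → ℚ}
    (h : ∀ i ∈ t, HasLead (f i) (d i) (c i)) :
    HasLead (∏ i ∈ t, f i) (∑ i ∈ t, d i) (∏ i ∈ t, c i) := by
  classical
  induction t using Finset.induction_on with
  | empty => simpa using one
  | insert i t hi ih =>
    rw [Finset.prod_insert hi, Finset.prod_insert hi, Finset.sum_insert hi]
    exact (h i (Finset.mem_insert_self i t)).mul
      (ih fun j hj => h j (Finset.mem_insert_of_mem hj))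

theorem degLT (hx : HasLead x d r) (hde : d < e) : DegLT x e :=
  Or.inr (hx.2.1.trans_lt hde)

theorem add_degLT (hx : HasLead x d r) (hy : DegLT y d) : HasLead (x + y) d r := by
  rcases eq_or_ne y 0 with rfl | hy0
  · simpa using hx
  replace hy := hy.resolve_left hy0
  obtain ⟨hx0, rfl, rfl⟩ := hx
  have hlt : y.denom.natDegree + x.num.natDegree > x.denom.natDegree + y.num.natDegree := by
    unfold RatFunc.intDegree at hy
    omega
  have hnx := RatFunc.num_ne_zero hx0
  have hny := RatFunc.num_ne_zero hy0
  have hdx := RatFunc.denom_ne_zero x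
  have hdy := RatFunc.denom_ne_zero y
  have hdeg : (x.denom * y.num).degree < (x.num * y.denom).degree := by
    apply Polynomial.degree_lt_degree
    rw [Polynomial.natDegree_mul hdx hny, Polynomial.natDegree_mul hnx hdy]
    omega
  have hlead := Polynomial.leadingCoeff_add_of_degree_lt' hdeg
  have hnat := Polynomial.natDegree_add_eq_left_of_degree_lt hdeg
  have hsum : x.num * y.denom + x.denom * y.num ≠ 0 := by
    rw [← Polynomial.leadingCoeff_ne_zero, hlead, Polynomial.leadingCoeff_ne_zero]
    exact mul_ne_zero hnx hdy
  have h := RatFunc.num_denom_add x y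
  have hxy : x + y ≠ 0 := by
    intro h0
    rw [h0, RatFunc.num_zero, RatFunc.denom_zero, zero_mul, mul_one] at h
    exact hsum h.symm
  refine ⟨hxy, ?_, ?_⟩
  · have hd := congrArg Polynomial.natDegree h
    rw [Polynomial.natDegree_mul (RatFunc.num_ne_zero hxy) (mul_ne_zero hdx hdy),
      Polynomial.natDegree_mul hdx hdy,
      Polynomial.natDegree_mul hsum (RatFunc.denom_ne_zero _), hnat,
      Polynomial.natDegree_mul hnx hdy] at hd
    unfold RatFunc.intDegree
    omega
  · have hl := congrArg Polynomial.leadingCoeff h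
    simp only [Polynomial.leadingCoeff_mul, hlead, (RatFunc.monic_denom _).leadingCoeff,
      mul_one] at hl
    simp [leadC, (RatFunc.monic_denom _).leadingCoeff, hl]

end HasLead

theorem DegLT.add {x y : RatFunc ℚ} {d : ℤ} (hx : DegLT x d) (hy : DegLT y d) :
    DegLT (x + y) d := by
  rcases eq_or_ne y 0 with rfl | hy0
  · simpa using hx
  rcases eq_or_ne x 0 with rfl | hx0
  · simpa using hy
  rcases eq_or_ne (x + y) 0 with h0 | h0
  · exact Or.inl h0
  · exact Or.inr ((RatFunc.intDegree_add_le hy0 h0).trans_lt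
      (max_lt (hx.resolve_left hx0) (hy.resolve_left hy0)))

theorem HasLead.sum {ι : Type*} {t : Finset ι} {f : ι → RatFunc ℚ} {d : ℤ} {c : ℚ} {i : ι}
    (hi : i ∈ t) (hfi : HasLead (f i) d c) (h : ∀ j ∈ t, j ≠ i → DegLT (f j) d) :
    HasLead (∑ j ∈ t, f j) d c := by
  classical
  rw [← Finset.add_sum_erase t f hi]
  refine hfi.add_degLT (Finset.sum_induction f (DegLT · d) (fun _ _ => DegLT.add)
    (Or.inl rfl) fun j hj => ?_)
  exact h j (Finset.mem_of_mem_erase hj) (Finset.ne_of_mem_erase hj)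

theorem hasLead_V : HasLead V 1 1 :=
  ⟨RatFunc.X_ne_zero, RatFunc.intDegree_X, by simp [leadC, V]⟩

theorem hasLead_neg_one : HasLead (-1) 0 (-1) := by
  have h : (-1 : RatFunc ℚ) = RatFunc.C (-1) := by simp
  refine ⟨by simp, ?_, ?_⟩
  · rw [h, RatFunc.intDegree_C]
  · rw [h, leadC, RatFunc.num_C, RatFunc.denom_C]
    simp

theorem hasLead_qint {k : ℤ} (hk : 0 < k) : HasLead (qint k) (2 * (k - 1)) 1 := by
  refine HasLead.sum (i := 0) (by simpa using hk) ?_ fun j _ hj => ?_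
  · simpa using hasLead_V.zpow (2 * (k - 1))
  · exact (hasLead_V.zpow _).degLT (by omega)

theorem hasLead_qfact {k : ℤ} (hk : 0 ≤ k) : HasLead (qfact k) (k * (k - 1)) 1 := by
  lift k to ℕ using hk
  have h := HasLead.prod (Finset.range k) fun j _ =>
    hasLead_qint (k := (j : ℤ) + 1) (by positivity)
  have hsum : ∑ j ∈ Finset.range k, 2 * ((j : ℤ) + 1 - 1) = k * (k - 1) := by
    clear h
    induction k with
    | zero => simp
    | succ k ih =>
      rw [Finset.sum_range_succ, ih]
      push_cast
      ring
  rw [hsum, Finset.prod_const_one] at h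
  simpa [qfact, not_lt.2 (Int.natCast_nonneg k)] using h

theorem hasLead_qO {k : ℤ} (hk : 0 ≤ k) : HasLead (qO k) (2 * k) ((-1) ^ k) := by
  simpa [qO] using (hasLead_neg_one.zpow k).mul (hasLead_qint (k := k + 1) (by omega))

theorem qbinom_eq_zero {n k : ℤ} (h : k < 0 ∨ n < k) : qbinom n k = 0 := by
  rcases h with h | h
  · simp [qbinom, qfact, h]
  · simp [qbinom, qfact, h]

theorem hasLead_qbinom {n k : ℤ} (hk : 0 ≤ k) (hkn : k ≤ n) :
    HasLead (qbinom n k) (g n k) 1 := by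
  have h := (hasLead_qfact (hk.trans hkn)).div
    ((hasLead_qfact hk).mul (hasLead_qfact (sub_nonneg.2 hkn)))
  have hdeg : n * (n - 1) - (k * (k - 1) + (n - k) * (n - k - 1)) = g n k := by
    unfold g
    ring
  rwa [hdeg, mul_one, div_one] at h

theorem hasLead_qO_mul_qbinom {z s : ℤ} (hs : 0 ≤ s) (hsz : s ≤ z) :
    HasLead (qO z / qO s * qbinom z s) (g (z + 1) (s + 1)) ((-1) ^ (z - s)) := by
  have h := ((hasLead_qO (hs.trans hsz)).div (hasLead_qO hs)).mul (hasLead_qbinom hs hsz)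
  convert h using 1
  · unfold g
    ring
  · rw [mul_one, zpow_sub₀ (by norm_num)]

/-- The summand of `qdelta`, with all the half-sums as parameters. -/
def deltaTerm (s n₁ n₂ n₃ t₁ t₂ t₃ z : ℤ) : RatFunc ℚ :=
  qO z / qO s * qbinom z s * qbinom n₁ (z - t₁) * qbinom n₂ (z - t₂) * qbinom n₃ (z - t₃)

/-- The degree of the summand `deltaTerm`. -/
def deltaTermDeg (s n₁ n₂ n₃ t₁ t₂ t₃ z : ℤ) : ℤ :=
  g (z + 1) (s + 1) + g n₁ (z - t₁) + g n₂ (z - t₂) + g n₃ (z - t₃)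

section deltaTerm

variable {s n₁ n₂ n₃ t₁ t₂ t₃ z m : ℤ}

theorem hasLead_deltaTerm (hs : 0 ≤ s) (hz : s ≤ z) (h₁ : t₁ ≤ z) (h₂ : t₂ ≤ z) (h₃ : t₃ ≤ z)
    (h₁' : z - t₁ ≤ n₁) (h₂' : z - t₂ ≤ n₂) (h₃' : z - t₃ ≤ n₃) :
    HasLead (deltaTerm s n₁ n₂ n₃ t₁ t₂ t₃ z) (deltaTermDeg s n₁ n₂ n₃ t₁ t₂ t₃ z)
      ((-1) ^ (z - s)) := by
  simpa [deltaTerm, deltaTermDeg] using (((hasLead_qO_mul_qbinom hs hz).mul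
    (hasLead_qbinom (sub_nonneg.2 h₁) h₁')).mul
    (hasLead_qbinom (sub_nonneg.2 h₂) h₂')).mul
    (hasLead_qbinom (sub_nonneg.2 h₃) h₃')

theorem deltaTermDeg_lt (hsum : n₁ + n₂ + n₃ = s)
    (h₁ : m - t₁ ≤ n₁) (h₂ : m - t₂ ≤ n₂) (h₃ : m - t₃ ≤ n₃) (hzm : z < m) :
    deltaTermDeg s n₁ n₂ n₃ t₁ t₂ t₃ z < deltaTermDeg s n₁ n₂ n₃ t₁ t₂ t₃ m := by
  rw [← sub_pos]
  have h : deltaTermDeg s n₁ n₂ n₃ t₁ t₂ t₃ m - deltaTermDeg s n₁ n₂ n₃ t₁ t₂ t₃ z =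
      2 * (m - z) * (1 + 3 * (m - z) + 2 * (n₁ - (m - t₁) + (n₂ - (m - t₂)) + (n₃ - (m - t₃)))) := by
    unfold deltaTermDeg g
    subst hsum
    ring
  rw [h]
  exact mul_pos (by omega) (by omega)

theorem deltaTerm_eq_zero (h : z < s ∨ z < t₁ ∨ z < t₂ ∨ z < t₃ ∨
    n₁ < z - t₁ ∨ n₂ < z - t₂ ∨ n₃ < z - t₃) :
    deltaTerm s n₁ n₂ n₃ t₁ t₂ t₃ z = 0 := by
  unfold deltaTerm
  rcases h with h | h | h | h | h | h | h
  · simp [qbinom_eq_zero (n := z) (k := s) (Or.inr h)]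
  · simp [qbinom_eq_zero (n := n₁) (k := z - t₁) (Or.inl (sub_neg.2 h))]
  · simp [qbinom_eq_zero (n := n₂) (k := z - t₂) (Or.inl (sub_neg.2 h))]
  · simp [qbinom_eq_zero (n := n₃) (k := z - t₃) (Or.inl (sub_neg.2 h))]
  · simp [qbinom_eq_zero (n := n₁) (k := z - t₁) (Or.inr h)]
  · simp [qbinom_eq_zero (n := n₂) (k := z - t₂) (Or.inr h)]
  · simp [qbinom_eq_zero (n := n₃) (k := z - t₃) (Or.inr h)]

theorem hasLead_finsum_deltaTerm (hs : 0 ≤ s) (hsum : n₁ + n₂ + n₃ = s) (hm : s ≤ m)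
    (h₁ : t₁ ≤ m) (h₂ : t₂ ≤ m) (h₃ : t₃ ≤ m)
    (h₁' : m - t₁ ≤ n₁) (h₂' : m - t₂ ≤ n₂) (h₃' : m - t₃ ≤ n₃)
    (hmax : m - t₁ = n₁ ∨ m - t₂ = n₂ ∨ m - t₃ = n₃) :
    HasLead (∑ᶠ z, deltaTerm s n₁ n₂ n₃ t₁ t₂ t₃ z) (deltaTermDeg s n₁ n₂ n₃ t₁ t₂ t₃ m)
      ((-1) ^ (m - s)) := by
  have hsupp : Function.support (deltaTerm s n₁ n₂ n₃ t₁ t₂ t₃) ⊆ ↑(Finset.Icc s m) := by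
    intro z hz
    by_contra hmem
    rw [Finset.mem_coe, Finset.mem_Icc] at hmem
    exact hz (deltaTerm_eq_zero (by omega))
  rw [finsum_eq_sum_of_support_subset _ hsupp]
  refine HasLead.sum (Finset.mem_Icc.2 ⟨hm, le_rfl⟩)
    (hasLead_deltaTerm hs hm h₁ h₂ h₃ h₁' h₂' h₃') fun z hz hzm => ?_
  rw [Finset.mem_Icc] at hz
  by_cases hlow : t₁ ≤ z ∧ t₂ ≤ z ∧ t₃ ≤ z
  · exact (hasLead_deltaTerm hs hz.1 hlow.1 hlow.2.1 hlow.2.2 (by omega) (by omega)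
      (by omega)).degLT (deltaTermDeg_lt hsum h₁' h₂' h₃' (by omega))
  · exact Or.inl (deltaTerm_eq_zero (by omega))

end deltaTerm

end CJP

open CJP in
/-- If all four triples `(a,b,c), (a,β,γ), (α,b,γ), (α,β,c)` are
admissible and `2m = a+b+c+α+β+γ - max(a+α, b+β, c+γ)`, then `Δ(a,b,c,α,β,γ)`
is nonzero, its `v`-degree equals
`g(m+1,(a+b+c)/2+1) + g((-a+b+c)/2, m-(a+β+γ)/2) + g((a-b+c)/2, m-(α+b+γ)/2)
  + g((a+b-c)/2, m-(α+β+c)/2)`,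
and its leading coefficient equals `(-1)^(m-(a+b+c)/2)`. -/
theorem delta_degree (a b c α β γ m : ℤ) (ha : 0 ≤ a) (hb : 0 ≤ b) (hc : 0 ≤ c)
    (hα : 0 ≤ α) (hβ : 0 ≤ β) (hγ : 0 ≤ γ)
    (h1 : Admissible a b c) (h2 : Admissible a β γ)
    (h3 : Admissible α b γ) (h4 : Admissible α β c)
    (hm : 2 * m = a + b + c + α + β + γ - max (max (a + α) (b + β)) (c + γ)) :
    qdelta a b c α β γ ≠ 0 ∧
    (qdelta a b c α β γ).intDegree =
      g (m + 1) ((a + b + c) / 2 + 1) + g ((-a + b + c) / 2) (m - (a + β + γ) / 2) +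
      g ((a - b + c) / 2) (m - (α + b + γ) / 2) +
      g ((a + b - c) / 2) (m - (α + β + c) / 2) ∧
    leadC (qdelta a b c α β γ) = (-1 : ℚ) ^ (m - (a + b + c) / 2) := by
  obtain ⟨d1, l1, u1⟩ := h1
  obtain ⟨d2, l2, u2⟩ := h2
  obtain ⟨d3, l3, u3⟩ := h3
  obtain ⟨d4, l4, u4⟩ := h4
  rw [abs_le] at l1 l2 l3 l4
  exact hasLead_finsum_deltaTerm (by omega) (by omega) (by omega) (by omega) (by omega)
    (by omega) (by omega) (by omega) (by omega) (by omega)
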